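/- Let p ≥ 0 and ψ ∈ C₀^∞(ℝ) with 0 ≤ ψ ≤ 1, supp ψ ⊂ [-2,2]. Then there is a constant C independent of p such that ‖⟨τ⟩^{1/2} 𝓕_t[ψ(t)e^{-p|t|}](τ)‖_{L²_τ} + p^{1/2}‖𝓕_t[ψ(t)e^{-p|t|}](τ)‖_{L²_τ} + ‖𝓕_t[ψ(t)e^{-p|t|}](τ)‖_{L¹_τ} ≤ C. -/

import Mathlib

open MeasureTheory

/-- `𝓕[ψ(t)e^{-p|t|}]` with convention `𝓕g(τ) = (2π)⁻¹∫ e^{-iτt}g(t)dt`. -/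
noncomputable def cutoffExpFT (ψ : ℝ → ℝ) (p τ : ℝ) : ℂ :=
  ((1 / (2 * Real.pi) : ℝ) : ℂ) *
    ∫ t : ℝ, Complex.exp (-Complex.I * (τ : ℂ) * (t : ℂ)) * ((ψ t * Real.exp (-p * |t|) : ℝ) : ℂ)

noncomputable def halfFT (φ : ℝ → ℝ) (z : ℂ) : ℂ :=
  ∫ t in (0:ℝ)..3, Complex.exp (-z * (t : ℂ)) * ((φ t : ℝ) : ℂ)

lemma halfFT_parts (φ : ℝ → ℝ) (hφ : ContDiff ℝ (⊤ : ℕ∞) φ) (h3 : φ 3 = 0) (z : ℂ) :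
    z * halfFT φ z = (φ 0 : ℂ) + halfFT (deriv φ) z := by
  have hd : Differentiable ℝ φ := hφ.differentiable (by simp)
  have hc : Continuous φ := hφ.continuous
  have hc' : Continuous (deriv φ) := hφ.continuous_deriv (by simp)
  have key : ∀ t ∈ Set.uIcc (0:ℝ) 3,
      HasDerivAt (fun t : ℝ => Complex.exp (-z * (t : ℂ)) * ((φ t : ℝ) : ℂ))
        (Complex.exp (-z * (t : ℂ)) * ((deriv φ t : ℝ) : ℂ)
          - z * (Complex.exp (-z * (t : ℂ)) * ((φ t : ℝ) : ℂ))) t := by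
    intro t _
    have e1 : HasDerivAt (fun t : ℝ => Complex.exp (-z * (t : ℂ)))
        (Complex.exp (-z * (t : ℂ)) * (-z * 1)) t :=
      ((Complex.ofRealCLM.hasDerivAt (x := t)).const_mul (-z)).cexp
    have e2 : HasDerivAt (fun t : ℝ => ((φ t : ℝ) : ℂ)) ((deriv φ t : ℝ) : ℂ) t :=
      (hd t).hasDerivAt.ofReal_comp
    exact (e1.mul e2).congr_deriv (by ring)
  have i1 : IntervalIntegrable
      (fun t : ℝ => Complex.exp (-z * (t : ℂ)) * ((deriv φ t : ℝ) : ℂ)) volume 0 3 :=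
    Continuous.intervalIntegrable (by fun_prop) _ _
  have i2 : IntervalIntegrable
      (fun t : ℝ => z * (Complex.exp (-z * (t : ℂ)) * ((φ t : ℝ) : ℂ))) volume 0 3 :=
    Continuous.intervalIntegrable (by fun_prop) _ _
  have := intervalIntegral.integral_eq_sub_of_hasDerivAt key (i1.sub i2)
  rw [intervalIntegral.integral_sub i1 i2, intervalIntegral.integral_const_mul] at this
  simp only [h3] at this
  simp at this
  unfold halfFT
  simp only [neg_mul]
  linear_combination -this

lemma halfFT_bound (φ : ℝ → ℝ) (hφ : Continuous φ) :
    ∃ K : ℝ, 0 ≤ K ∧ ∀ z : ℂ, 0 ≤ z.re → ‖halfFT φ z‖ ≤ K := by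
  obtain ⟨B, hB⟩ := (isCompact_Icc (a := (0:ℝ)) (b := 3)).exists_bound_of_continuousOn
    hφ.continuousOn
  have hB0 : 0 ≤ B := (norm_nonneg _).trans (hB 0 (by norm_num))
  refine ⟨B * 3, by positivity, fun z hz => ?_⟩
  have := intervalIntegral.norm_integral_le_of_norm_le_const (a := (0:ℝ)) (b := 3) (C := B)
    (f := fun t : ℝ => Complex.exp (-z * (t : ℂ)) * ((φ t : ℝ) : ℂ)) (by
      intro t ht
      rw [Set.uIoc_of_le (by norm_num)] at ht
      have h1 := hB t ⟨ht.1.le, ht.2⟩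
      rw [norm_mul, Complex.norm_exp, Complex.norm_real]
      have : Real.exp (-z * (t:ℂ)).re ≤ 1 := by
        rw [Real.exp_le_one_iff]
        simp
        exact mul_nonneg hz ht.1.le
      calc _ ≤ 1 * B := by gcongr
        _ = B := one_mul _)
  simpa [halfFT] using this

lemma halfFT_all (φ : ℝ → ℝ) (hφ : ContDiff ℝ (⊤ : ℕ∞) φ) (h3 : φ =ᶠ[nhds 3] 0) :
    ∃ K : ℝ, 0 ≤ K ∧ ∀ z : ℂ, 0 ≤ z.re → ‖halfFT φ z‖ ≤ K ∧ ‖z‖ * ‖halfFT φ z‖ ≤ K ∧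
      ‖z‖ ^ 2 * ‖halfFT φ z - (φ 0 : ℂ) / z‖ ≤ K := by
  have hφ' : ContDiff ℝ (⊤ : ℕ∞) (deriv φ) := by
    have := (contDiff_infty_iff_deriv (f := φ)).1 hφ
    exact this.2
  have d3 : deriv φ 3 = 0 := by
    rw [h3.deriv_eq]; simp
  obtain ⟨K0, k0, H0⟩ := halfFT_bound φ hφ.continuous
  obtain ⟨K1, k1, H1⟩ := halfFT_bound _ hφ'.continuous
  obtain ⟨K2, k2, H2⟩ := halfFT_bound _ (hφ'.continuous_deriv (by simp))
  refine ⟨K0 + (|φ 0| + K1) + (|deriv φ 0| + K2), by positivity, fun z hz => ?_⟩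
  have a1 := abs_nonneg (φ 0)
  have a2 := abs_nonneg (deriv φ 0)
  have p1 := halfFT_parts φ hφ h3.self_of_nhds z
  have p2 := halfFT_parts _ hφ' d3 z
  refine ⟨by linarith [H0 z hz], ?_, ?_⟩
  · rw [← norm_mul, p1]
    have := norm_add_le (φ 0 : ℂ) (halfFT (deriv φ) z)
    rw [Complex.norm_real, Real.norm_eq_abs] at this
    linarith [H1 z hz]
  · by_cases hz0 : z = 0
    · subst hz0; simp; positivity
    rw [← norm_pow, ← norm_mul]
    have e : z ^ 2 * (halfFT φ z - (φ 0 : ℂ) / z) =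
        ((deriv φ 0 : ℝ) : ℂ) + halfFT (deriv (deriv φ)) z := by
      rw [← p2]
      field_simp
      linear_combination p1
    rw [e]
    have := norm_add_le ((deriv φ 0 : ℝ) : ℂ) (halfFT (deriv (deriv φ)) z)
    rw [Complex.norm_real, Real.norm_eq_abs] at this
    linarith [H2 z hz]

lemma cutoff_split (ψ : ℝ → ℝ) (hψ : Continuous ψ)
    (hsupp : tsupport ψ ⊆ Set.Icc (-2 : ℝ) 2) (p τ : ℝ) :
    cutoffExpFT ψ p τ = ((1 / (2 * Real.pi) : ℝ) : ℂ) *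
      (halfFT ψ ⟨p, τ⟩ + halfFT (fun t => ψ (-t)) ⟨p, -τ⟩) := by
  unfold cutoffExpFT
  congr 1
  set f : ℝ → ℂ := fun t => Complex.exp (-Complex.I * (τ : ℂ) * (t : ℂ)) *
    ((ψ t * Real.exp (-p * |t|) : ℝ) : ℂ) with hf
  have hfc : Continuous f := by fun_prop
  have hs : Function.support f ⊆ Set.Ioc (-3) 3 := by
    intro t ht
    have : ψ t ≠ 0 := by
      intro h; apply ht; simp [hf, h]
    have := hsupp (subset_tsupport _ this)
    exact ⟨by linarith [this.1], by linarith [this.2]⟩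
  rw [← intervalIntegral.integral_eq_integral_of_support_subset hs,
    ← intervalIntegral.integral_add_adjacent_intervals (b := 0)
      (hfc.intervalIntegrable _ _) (hfc.intervalIntegrable _ _), add_comm]
  congr 1
  · unfold halfFT
    apply intervalIntegral.integral_congr
    intro t ht
    rw [Set.uIcc_of_le (by norm_num)] at ht
    simp only [hf, abs_of_nonneg ht.1]
    push_cast
    rw [mul_comm (ψ t : ℂ), ← mul_assoc, ← Complex.exp_add, Complex.mk_eq_add_mul_I]
    congr 2
    ring
  · have := intervalIntegral.integral_comp_neg f (a := 0) (b := 3)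
    rw [neg_zero] at this
    rw [← this]
    unfold halfFT
    apply intervalIntegral.integral_congr
    intro t ht
    rw [Set.uIcc_of_le (by norm_num)] at ht
    simp only [hf, abs_neg, abs_of_nonneg ht.1]
    push_cast
    rw [mul_comm (ψ (-t) : ℂ), ← mul_assoc, ← Complex.exp_add, Complex.mk_eq_add_mul_I]
    congr 2
    push_cast
    ring

lemma cutoff_pointwise (ψ : ℝ → ℝ) (hψ : ContDiff ℝ (⊤ : ℕ∞) ψ)
    (hsupp : tsupport ψ ⊆ Set.Icc (-2 : ℝ) 2) :
    ∃ K : ℝ, 0 ≤ K ∧ ∀ p τ : ℝ, 0 ≤ p →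
      (1 + |τ|) * ‖cutoffExpFT ψ p τ‖ ≤ K ∧ p * ‖cutoffExpFT ψ p τ‖ ≤ K ∧
      ‖cutoffExpFT ψ p τ‖ ≤ K * (p / (p ^ 2 + τ ^ 2) + (1 + τ ^ 2)⁻¹) := by
  have ev : ∀ x : ℝ, x ∉ Set.Icc (-2:ℝ) 2 → ψ =ᶠ[nhds x] 0 := fun x hx =>
    notMem_tsupport_iff_eventuallyEq.1 (fun h => hx (hsupp h))
  obtain ⟨K1, k1, H1⟩ := halfFT_all ψ hψ (ev 3 (by norm_num))
  obtain ⟨K2, k2, H2⟩ := halfFT_all (fun t => ψ (-t)) (hψ.comp contDiff_neg) (by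
    have h : Filter.Tendsto (fun t : ℝ => -t) (nhds 3) (nhds (-3)) :=
      continuous_neg.tendsto _
    exact h.eventually (ev (-3) (by norm_num)))
  refine ⟨2 * (K1 + K2) + 2 * |ψ 0|, by positivity, fun p τ hp => ?_⟩
  have a0 := abs_nonneg (ψ 0)
  obtain ⟨b1, c1, d1⟩ := H1 ⟨p, τ⟩ hp
  obtain ⟨b2, c2, d2⟩ := H2 ⟨p, -τ⟩ hp
  set A := halfFT ψ ⟨p, τ⟩
  set B := halfFT (fun t => ψ (-t)) ⟨p, -τ⟩
  have hF : ‖cutoffExpFT ψ p τ‖ ≤ ‖A + B‖ := by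
    rw [cutoff_split ψ hψ.continuous hsupp, norm_mul, Complex.norm_real]
    have : ‖1 / (2 * Real.pi)‖ ≤ 1 := by
      rw [Real.norm_of_nonneg (by positivity), div_le_one (by positivity)]
      linarith [Real.pi_gt_three]
    exact mul_le_of_le_one_left (norm_nonneg _) this
  have nz : ‖(⟨p, -τ⟩ : ℂ)‖ = ‖(⟨p, τ⟩ : ℂ)‖ := by
    simp [Complex.norm_def, Complex.normSq_mk]
  rw [nz] at c2 d2
  have zp : p ≤ ‖(⟨p, τ⟩ : ℂ)‖ := Complex.re_le_norm ⟨p, τ⟩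
  have zt : |τ| ≤ ‖(⟨p, τ⟩ : ℂ)‖ := Complex.abs_im_le_norm ⟨p, τ⟩
  have zs : ‖(⟨p, τ⟩ : ℂ)‖ ^ 2 = p ^ 2 + τ ^ 2 := by
    rw [Complex.sq_norm, Complex.normSq_mk]; ring
  have tri := norm_add_le A B
  have nA := norm_nonneg A
  have nB := norm_nonneg B
  have nAB := norm_nonneg (A + B)
  set n := ‖(⟨p, τ⟩ : ℂ)‖
  have nn : 0 ≤ n := norm_nonneg _
  have hn : n * ‖cutoffExpFT ψ p τ‖ ≤ K1 + K2 := by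
    calc _ ≤ n * (‖A‖ + ‖B‖) := by gcongr; exact hF.trans tri
      _ ≤ _ := by linarith
  have nF := norm_nonneg (cutoffExpFT ψ p τ)
  refine ⟨?_, ?_, ?_⟩
  · have : |τ| * ‖cutoffExpFT ψ p τ‖ ≤ n * ‖cutoffExpFT ψ p τ‖ := by gcongr
    linarith
  · have : p * ‖cutoffExpFT ψ p τ‖ ≤ n * ‖cutoffExpFT ψ p τ‖ := by gcongr
    linarith
  · have q1 : 0 ≤ p / (p ^ 2 + τ ^ 2) := by positivity
    have q2 : 0 ≤ (1 + τ ^ 2)⁻¹ := by positivity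
    by_cases hN : p ^ 2 + τ ^ 2 < 1
    · have : 1 ≤ 2 * (1 + τ ^ 2)⁻¹ := by
        rw [← div_eq_mul_inv, le_div_iff₀ (by positivity)]
        nlinarith [sq_nonneg p]
      have t1 : (K1 + K2) * 1 ≤ (K1 + K2) * (2 * (1 + τ ^ 2)⁻¹) := by gcongr
      nlinarith [mul_nonneg a0 q1, mul_nonneg a0 q2, mul_nonneg (add_nonneg k1 k2) q1]
    · push Not at hN
      have Npos : 0 < p ^ 2 + τ ^ 2 := by linarith
      have zne : (⟨p, τ⟩ : ℂ) ≠ 0 := by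
        intro h
        have h1 := congrArg Complex.re h
        have h2 := congrArg Complex.im h
        simp at h1 h2
        subst h1 h2; simp at Npos
      have zne' : (⟨p, -τ⟩ : ℂ) ≠ 0 := by
        intro h
        have h1 := congrArg Complex.re h
        have h2 := congrArg Complex.im h
        simp at h1 h2
        subst h1 h2; simp at Npos
      have sum : (ψ 0 : ℂ) / ⟨p, τ⟩ + (ψ 0 : ℂ) / ⟨p, -τ⟩ =
          ((ψ 0 * (2 * (p / (p ^ 2 + τ ^ 2))) : ℝ) : ℂ) := by
        have hm : (⟨p, τ⟩ : ℂ) * ⟨p, -τ⟩ = ((p ^ 2 + τ ^ 2 : ℝ) : ℂ) := by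
          apply Complex.ext
          · rw [Complex.ofReal_re, Complex.mul_re]; ring
          · rw [Complex.ofReal_im, Complex.mul_im]; ring
        have hs : (⟨p, -τ⟩ : ℂ) + ⟨p, τ⟩ = ((2 * p : ℝ) : ℂ) := by
          apply Complex.ext <;> simp; ring
        rw [div_add_div _ _ zne zne', hm, mul_comm (⟨p, τ⟩ : ℂ), ← mul_add, hs]
        push_cast; ring
      simp only [neg_zero] at d2
      have e : A + B = (A - (ψ 0 : ℂ) / ⟨p, τ⟩) + (B - (ψ 0 : ℂ) / ⟨p, -τ⟩) +
          ((ψ 0 * (2 * (p / (p ^ 2 + τ ^ 2))) : ℝ) : ℂ) := by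
        rw [← sum]; ring
      have t1 := norm_add₃_le (a := A - (ψ 0 : ℂ) / ⟨p, τ⟩) (b := B - (ψ 0 : ℂ) / ⟨p, -τ⟩)
        (c := ((ψ 0 * (2 * (p / (p ^ 2 + τ ^ 2))) : ℝ) : ℂ))
      rw [← e] at t1
      rw [Complex.norm_real, Real.norm_eq_abs, abs_mul,
        abs_of_nonneg (show 0 ≤ 2 * (p / (p ^ 2 + τ ^ 2)) by positivity)] at t1
      rw [zs, mul_comm, ← le_div_iff₀ Npos] at d1 d2
      have hi : (p ^ 2 + τ ^ 2)⁻¹ ≤ 2 * (1 + τ ^ 2)⁻¹ := by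
        rw [← div_eq_mul_inv, inv_eq_one_div, div_le_div_iff₀ Npos (by positivity)]
        nlinarith [sq_nonneg p]
      have t2 : (K1 + K2) * (p ^ 2 + τ ^ 2)⁻¹ ≤ (K1 + K2) * (2 * (1 + τ ^ 2)⁻¹) := by gcongr
      rw [div_eq_mul_inv K1] at d1
      rw [div_eq_mul_inv K2] at d2
      nlinarith [mul_nonneg a0 q1, mul_nonneg a0 q2, mul_nonneg (add_nonneg k1 k2) q1]

lemma poisson_int (p : ℝ) (hp : 0 ≤ p) :
    Integrable (fun τ : ℝ => p / (p ^ 2 + τ ^ 2)) ∧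
      ∫ τ : ℝ, p / (p ^ 2 + τ ^ 2) ≤ Real.pi := by
  rcases hp.eq_or_lt with rfl | hp
  · simp [Real.pi_pos.le]
  have e : (fun τ : ℝ => p / (p ^ 2 + τ ^ 2)) = fun τ => p⁻¹ * (1 + (τ / p) ^ 2)⁻¹ := by
    ext τ
    have : 0 < p ^ 2 + τ ^ 2 := by positivity
    field_simp
  rw [e]
  refine ⟨(integrable_inv_one_add_sq.comp_div hp.ne').const_mul _, ?_⟩
  rw [integral_const_mul, Measure.integral_comp_div (fun x : ℝ => (1 + x ^ 2)⁻¹),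
    integral_univ_inv_one_add_sq, abs_of_pos hp, smul_eq_mul, inv_mul_cancel_left₀ hp.ne']

/-- For `ψ ∈ C₀^∞(ℝ)` with `0 ≤ ψ ≤ 1` and `supp ψ ⊆ [-2,2]`, there is a constant `C`
independent of `p ≥ 0` bounding
`‖⟨τ⟩^{1/2}𝓕[ψe^{-p|t|}]‖_{L²} + p^{1/2}‖𝓕[ψe^{-p|t|}]‖_{L²} + ‖𝓕[ψe^{-p|t|}]‖_{L¹}`. -/
theorem cutoff_exp_fourier_bound (ψ : ℝ → ℝ) (hψ : ContDiff ℝ (⊤ : ℕ∞) ψ)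
    (hcpt : HasCompactSupport ψ) (hsupp : tsupport ψ ⊆ Set.Icc (-2 : ℝ) 2)
    (h0 : ∀ t, 0 ≤ ψ t) (h1 : ∀ t, ψ t ≤ 1) :
    ∃ C : ℝ, ∀ p : ℝ, 0 ≤ p →
      Real.sqrt (∫ τ : ℝ, Real.sqrt (1 + τ ^ 2) * ‖cutoffExpFT ψ p τ‖ ^ 2) +
          Real.sqrt p * Real.sqrt (∫ τ : ℝ, ‖cutoffExpFT ψ p τ‖ ^ 2) +
          (∫ τ : ℝ, ‖cutoffExpFT ψ p τ‖) ≤ C := by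
  obtain ⟨K, k, H⟩ := cutoff_pointwise ψ hψ hsupp
  set L := K * (Real.pi + Real.pi) with hL
  refine ⟨Real.sqrt (K * L) + Real.sqrt (K * L) + L, fun p hp => ?_⟩
  obtain ⟨i1, l1⟩ := poisson_int p hp
  set g : ℝ → ℝ := fun τ => K * (p / (p ^ 2 + τ ^ 2) + (1 + τ ^ 2)⁻¹) with hg
  have gi : Integrable g := (i1.add integrable_inv_one_add_sq).const_mul K
  have gl : ∫ τ, g τ ≤ L := by
    rw [hg, integral_const_mul, integral_add i1 integrable_inv_one_add_sq,
      integral_univ_inv_one_add_sq]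
    exact mul_le_mul_of_nonneg_left (by linarith) k
  have gKl : ∫ τ, K * g τ ≤ K * L := by
    rw [integral_const_mul]; gcongr
  gcongr ?_ + ?_ + ?_
  · apply Real.sqrt_le_sqrt
    refine (integral_mono_of_nonneg (.of_forall fun τ => by positivity) (gi.const_mul K)
      (.of_forall fun τ => ?_)).trans gKl
    obtain ⟨a, b, c⟩ := H p τ hp
    have s : Real.sqrt (1 + τ ^ 2) ≤ 1 + |τ| := by
      rw [Real.sqrt_le_left (by positivity)]
      nlinarith [sq_abs τ, abs_nonneg τ]
    calc Real.sqrt (1 + τ ^ 2) * ‖cutoffExpFT ψ p τ‖ ^ 2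
        ≤ (1 + |τ|) * ‖cutoffExpFT ψ p τ‖ ^ 2 := by gcongr
      _ = ((1 + |τ|) * ‖cutoffExpFT ψ p τ‖) * ‖cutoffExpFT ψ p τ‖ := by ring
      _ ≤ K * g τ := by gcongr
  · rw [← Real.sqrt_mul hp, ← integral_const_mul]
    apply Real.sqrt_le_sqrt
    refine (integral_mono_of_nonneg (.of_forall fun τ => by positivity) (gi.const_mul K)
      (.of_forall fun τ => ?_)).trans gKl
    obtain ⟨a, b, c⟩ := H p τ hp
    calc p * ‖cutoffExpFT ψ p τ‖ ^ 2
        = (p * ‖cutoffExpFT ψ p τ‖) * ‖cutoffExpFT ψ p τ‖ := by ring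
      _ ≤ K * g τ := by gcongr
  · exact (integral_mono_of_nonneg (.of_forall fun τ => norm_nonneg _) gi
      (.of_forall fun τ => (H p τ hp).2.2)).trans gl
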